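/- For every integer n >= 1, the identity P(n) = (p(n) + (2/n) * sum over i = 1,...,n-1 of i * P(i)) / n holds; equivalently, n^2 * P(n) = n * p(n) + 2 * sum over i = 1,...,n-1 of i * P(i). -/

import Mathlib

namespace BalancedTrees

/-- Plane binary trees with vertices labeled by natural numbers;
`nil` is the empty tree, and each child of a vertex is designated
as a left child or a right child. -/
inductive BT where
  | nil : BT
  | node (label : ℕ) (l r : BT) : BT
deriving DecidableEq

namespace BT

/-- `balRank t = some k` if and only if the root of `t` is a balanced vertex of
rank `k`, i.e. every descending path from the root to a leaf has length `k`. -/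
def balRank : BT → Option ℕ
  | .nil => none
  | .node _ .nil .nil => some 0
  | .node _ .nil (.node b rl rr) => (balRank (BT.node b rl rr)).map (· + 1)
  | .node _ (.node a ll lr) .nil => (balRank (BT.node a ll lr)).map (· + 1)
  | .node _ (.node a ll lr) (.node b rl rr) =>
      match balRank (BT.node a ll lr), balRank (BT.node b rl rr) with
      | some i, some j => if i = j then some (i + 1) else none
      | _, _ => none

/-- The number of balanced vertices of rank `k` in the tree `t`. -/
def countBal (k : ℕ) : BT → ℕ
  | .nil => 0
  | .node v l r =>
      countBal k l + countBal k r +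
        (if balRank (BT.node v l r) = some k then 1 else 0)

/-- The number of balanced vertices (of any rank) in the tree `t`. -/
def countBalAll : BT → ℕ
  | .nil => 0
  | .node v l r =>
      countBalAll l + countBalAll r +
        (if (balRank (BT.node v l r)).isSome then 1 else 0)

/-- Auxiliary, fuelled version of `treeOf`. -/
def treeOfAux : ℕ → List ℕ → BT
  | 0, _ => .nil
  | _ + 1, [] => .nil
  | fuel + 1, l =>
      let m := l.foldr max 0
      BT.node m (treeOfAux fuel (l.takeWhile (· != m)))
                (treeOfAux fuel ((l.dropWhile (· != m)).tail))

/-- The decreasing binary tree `T(π)` of a sequence `π` of distinct labels: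
the root is the maximum entry, and its left (resp. right) subtree is built
recursively from the part of the sequence to the left (resp. right) of the
maximum. This is a bijection between permutations of `{1,…,n}` and
decreasing binary trees on `{1,…,n}`. -/
def treeOf (l : List ℕ) : BT := treeOfAux l.length l

/-- Canonical form for non-plane 1-2 trees (as represented by plane trees):
an only child is stored as a left child, and of two (unordered) children the
one with the larger label is stored on the left. Decreasing binary trees in
canonical form are in bijection with non-plane 1-2 trees. -/
def canonNP : BT → Bool
  | .nil => true
  | .node _ l r =>
      canonNP l && canonNP r &&
        (match l, r with
         | .nil, .nil => true
         | .node _ _ _, .nil => true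
         | .nil, .node _ _ _ => false
         | .node a _ _, .node b _ _ => decide (b < a))

/-- Canonical form for plane 1-2 trees: an only child is stored as a left
child (an only child carries no left/right designation), while two children
remain ordered. Decreasing binary trees in canonical form are in bijection
with plane 1-2 trees. -/
def canonP : BT → Bool
  | .nil => true
  | .node _ l r =>
      canonP l && canonP r &&
        (match l, r with
         | .nil, .node _ _ _ => false
         | _, _ => true)

end BT

open BT

/-- The list of all permutations of `{1,…,n}`, each written as a list. -/
def perms (n : ℕ) : List (List ℕ) := (List.range' 1 n).permutations

/-- `a n k`: the total number of balanced vertices of rank `k` over all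
decreasing binary trees on `{1,…,n}`. -/
def a (n k : ℕ) : ℕ := ((perms n).map fun l => countBal k (treeOf l)).sum

/-- `r n k`: the number of decreasing binary trees on `{1,…,n}` whose root is
balanced of rank `k`. -/
def r (n k : ℕ) : ℕ :=
  ((perms n).filter fun l => decide (balRank (treeOf l) = some k)).length

/-- `p n k`: the probability that the root of a uniformly random decreasing
binary tree on `{1,…,n}` is balanced of rank `k`; by convention `p 0 k = 1`. -/
def p (n k : ℕ) : ℚ := if n = 0 then 1 else (r n k : ℚ) / (Nat.factorial n : ℚ)

/-- The number of decreasing binary trees on `{1,…,n}` whose root is balanced. -/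
def rootBal (n : ℕ) : ℕ :=
  ((perms n).filter fun l => (balRank (treeOf l)).isSome).length

/-- `proot n`: the probability that the root of a uniformly random decreasing
binary tree on `{1,…,n}` is balanced. -/
def proot (n : ℕ) : ℚ := (rootBal n : ℚ) / (Nat.factorial n : ℚ)

/-- The total number of balanced vertices over all decreasing binary trees
on `{1,…,n}`. -/
def totalBal (n : ℕ) : ℕ := ((perms n).map fun l => countBalAll (treeOf l)).sum

/-- `Pbal n`: the probability that a vertex chosen uniformly at random from
the `n * n!` vertices of all decreasing binary trees on `{1,…,n}` is balanced. -/
def Pbal (n : ℕ) : ℚ := (totalBal n : ℚ) / ((n : ℚ) * (Nat.factorial n : ℚ))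

/-- Permutations whose decreasing binary tree is a canonical representative
of a non-plane 1-2 tree; these are in bijection with non-plane 1-2 trees
on `{1,…,n}`. -/
def npPerms (n : ℕ) : List (List ℕ) := (perms n).filter fun l => canonNP (treeOf l)

/-- `E n`: the number of non-plane 1-2 trees on `{1,…,n}` (the Euler number). -/
def E (n : ℕ) : ℕ := (npPerms n).length

/-- `b n k`: the total number of balanced vertices of rank `k` over all
non-plane 1-2 trees on `{1,…,n}`. -/
def b (n k : ℕ) : ℕ := ((npPerms n).map fun l => countBal k (treeOf l)).sum

/-- `s n k`: the number of non-plane 1-2 trees on `{1,…,n}` whose root is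
balanced of rank `k`. -/
def s (n k : ℕ) : ℕ :=
  ((npPerms n).filter fun l => decide (balRank (treeOf l) = some k)).length

/-- Permutations whose decreasing binary tree is a canonical representative
of a plane 1-2 tree; these are in bijection with plane 1-2 trees on `{1,…,n}`. -/
def pPerms (n : ℕ) : List (List ℕ) := (perms n).filter fun l => canonP (treeOf l)

/-- `z n`: the number of plane 1-2 trees on `{1,…,n}`. -/
def z (n : ℕ) : ℕ := (pPerms n).length

/-- `d n k`: the total number of balanced vertices of rank `k` over all
plane 1-2 trees on `{1,…,n}`. -/
def d (n k : ℕ) : ℕ := ((pPerms n).map fun l => countBal k (treeOf l)).sum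

/-- `t n k`: the number of plane 1-2 trees on `{1,…,n}` whose root is
balanced of rank `k`. -/
def t (n k : ℕ) : ℕ :=
  ((pPerms n).filter fun l => decide (balRank (treeOf l) = some k)).length

end BalancedTrees

namespace BalancedTrees

namespace BT

lemma foldr_max_eq {l : List ℕ} {m : ℕ} (hm : m ∈ l) (h : ∀ x ∈ l, x ≤ m) :
    l.foldr max 0 = m := by
  apply le_antisymm
  · exact List.max_le_of_forall_le l m h
  · exact List.le_max_of_le' 0 hm le_rfl

lemma foldr_max_mem {l : List ℕ} (hl : l ≠ []) : l.foldr max 0 ∈ l := by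
  induction l with
  | nil => exact absurd rfl hl
  | cons a t ih =>
    rcases eq_or_ne t [] with rfl | ht
    · simp
    · rcases max_choice a (t.foldr max 0) with h | h
      · simp [h]
      · simp [h, ih ht]

lemma le_foldr_max {l : List ℕ} {x : ℕ} (hx : x ∈ l) : x ≤ l.foldr max 0 :=
  List.le_max_of_le' 0 hx le_rfl

/-- Apply a function to every label of a tree. -/
def relabel (g : ℕ → ℕ) : BT → BT
  | .nil => .nil
  | .node v l r => .node (g v) (relabel g l) (relabel g r)

lemma balRank_relabel (g : ℕ → ℕ) (t : BT) : balRank (relabel g t) = balRank t := by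
  induction t with
  | nil => rfl
  | node v l r hl hr =>
    cases l <;> cases r <;> simp_all [relabel, balRank]

lemma countBalAll_relabel (g : ℕ → ℕ) (t : BT) :
    countBalAll (relabel g t) = countBalAll t := by
  induction t with
  | nil => rfl
  | node v l r hl hr =>
    have h := balRank_relabel g (.node v l r)
    simp only [relabel] at h
    simp [relabel, countBalAll, hl, hr, h]

lemma treeOfAux_succ (k : ℕ) {l : List ℕ} (hl : l ≠ []) :
    treeOfAux (k + 1) l = .node (l.foldr max 0)
      (treeOfAux k (l.takeWhile (· != l.foldr max 0)))
      (treeOfAux k ((l.dropWhile (· != l.foldr max 0)).tail)) := by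
  cases l with
  | nil => exact absurd rfl hl
  | cons a t => rfl

lemma treeOfAux_nil (k : ℕ) : treeOfAux k [] = .nil := by
  cases k <;> rfl

lemma foldr_max_map {g : ℕ → ℕ} {l : List ℕ} (hl : l ≠ [])
    (hg : StrictMonoOn g {x | x ∈ l}) :
    (l.map g).foldr max 0 = g (l.foldr max 0) := by
  apply foldr_max_eq (List.mem_map_of_mem (foldr_max_mem hl))
  intro y hy
  obtain ⟨x, hx, rfl⟩ := List.mem_map.1 hy
  exact hg.monotoneOn hx (foldr_max_mem hl) (le_foldr_max hx)

lemma treeOfAux_map {g : ℕ → ℕ} (k : ℕ) {l : List ℕ} (hg : StrictMonoOn g {x | x ∈ l}) :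
    treeOfAux k (l.map g) = relabel g (treeOfAux k l) := by
  induction k generalizing l with
  | zero => rfl
  | succ k ih =>
    rcases eq_or_ne l [] with rfl | hl
    · rfl
    have hp : ∀ x ∈ l, (g x != g (l.foldr max 0)) = (x != l.foldr max 0) := fun x hx => by
      simp only [bne, Bool.not_inj_iff, Bool.beq_eq_decide_eq, decide_eq_decide]
      exact hg.injOn.eq_iff hx (foldr_max_mem hl)
    have key : ∀ (p q : ℕ → Bool) (l : List ℕ), (∀ x ∈ l, p (g x) = q x) →
        (l.map g).takeWhile p = (l.takeWhile q).map g ∧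
        (l.map g).dropWhile p = (l.dropWhile q).map g := by
      intro p q l h
      induction l with
      | nil => simp
      | cons a t iht =>
        have ha := h a (by simp)
        have iht := iht fun x hx => h x (by simp [hx])
        cases hq : q a <;> simp_all
    obtain ⟨h1, h2⟩ := key (· != g (l.foldr max 0)) (· != l.foldr max 0) l hp
    rw [treeOfAux_succ k hl, treeOfAux_succ k (by simpa using hl), foldr_max_map hl hg, h1, h2,
      ← List.map_tail, ih, ih]
    · rfl
    · exact hg.mono fun x hx => (List.dropWhile_sublist _).subset (List.mem_of_mem_tail hx)
    · exact hg.mono fun x hx => (List.takeWhile_sublist _).subset hx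

lemma treeOf_map {g : ℕ → ℕ} {l : List ℕ} (hg : StrictMonoOn g {x | x ∈ l}) :
    treeOf (l.map g) = relabel g (treeOf l) := by
  simp only [treeOf, List.length_map, treeOfAux_map _ hg]

lemma takeWhile_bne_append_cons {l₁ l₂ : List ℕ} {m : ℕ} (h : m ∉ l₁) :
    (l₁ ++ m :: l₂).takeWhile (· != m) = l₁ := by
  rw [List.takeWhile_append_of_pos (by rintro x hx; simpa using ne_of_mem_of_not_mem hx h)]
  simp

lemma dropWhile_bne_append_cons {l₁ l₂ : List ℕ} {m : ℕ} (h : m ∉ l₁) :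
    (l₁ ++ m :: l₂).dropWhile (· != m) = m :: l₂ := by
  rw [List.dropWhile_append_of_pos (by rintro x hx; simpa using ne_of_mem_of_not_mem hx h)]
  simp

lemma treeOfAux_append_cons (k : ℕ) {l₁ l₂ : List ℕ} {m : ℕ} (h₁ : ∀ x ∈ l₁, x < m)
    (h₂ : ∀ x ∈ l₂, x < m) :
    treeOfAux (k + 1) (l₁ ++ m :: l₂) = .node m (treeOfAux k l₁) (treeOfAux k l₂) := by
  have hm : (l₁ ++ m :: l₂).foldr max 0 = m := foldr_max_eq (by simp) fun x hx => by
    rcases List.mem_append.1 hx with hx | hx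
    · exact (h₁ x hx).le
    · rcases List.mem_cons.1 hx with rfl | hx
      · exact le_rfl
      · exact (h₂ x hx).le
  have hn : m ∉ l₁ := fun h => lt_irrefl _ (h₁ m h)
  rw [treeOfAux_succ k (by simp), hm, takeWhile_bne_append_cons hn, dropWhile_bne_append_cons hn,
    List.tail_cons]

lemma treeOfAux_eq_treeOf {k : ℕ} {l : List ℕ} (hk : l.length ≤ k) :
    treeOfAux k l = treeOf l := by
  have key : ∀ (j k : ℕ) (l : List ℕ), l.length ≤ j → l.length ≤ k →
      treeOfAux j l = treeOfAux k l := by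
    intro j
    induction j with
    | zero =>
      intro k l hj _
      rw [List.eq_nil_of_length_eq_zero (Nat.le_zero.1 hj), treeOfAux_nil, treeOfAux_nil]
    | succ j ih =>
      intro k l hj hk
      rcases eq_or_ne l [] with rfl | hl
      · rw [treeOfAux_nil, treeOfAux_nil]
      have hpos := List.length_pos_iff.2 hl
      obtain ⟨k, rfl⟩ : ∃ i, k = i + 1 := ⟨k - 1, by omega⟩
      have hsplit := congrArg List.length
        (List.takeWhile_append_dropWhile (p := (· != l.foldr max 0)) (l := l))
      have hne : l.dropWhile (· != l.foldr max 0) ≠ [] := by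
        rw [Ne, List.dropWhile_eq_nil_iff]
        intro h
        simpa using h _ (foldr_max_mem hl)
      have hdrop := List.length_pos_iff.2 hne
      rw [List.length_append] at hsplit
      rw [treeOfAux_succ j hl, treeOfAux_succ k hl, ih k, ih k] <;>
        (try rw [List.length_tail]) <;> omega
  exact key _ _ _ hk le_rfl

lemma treeOf_append_cons {l₁ l₂ : List ℕ} {m : ℕ} (h₁ : ∀ x ∈ l₁, x < m)
    (h₂ : ∀ x ∈ l₂, x < m) :
    treeOf (l₁ ++ m :: l₂) = .node m (treeOf l₁) (treeOf l₂) := by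
  rw [← treeOfAux_eq_treeOf (k := l₁.length + l₂.length + 1) (by simp; omega),
    treeOfAux_append_cons _ h₁ h₂, treeOfAux_eq_treeOf (by omega), treeOfAux_eq_treeOf (by omega)]

end BT

open BT

/-- The linear orderings of a finite set of labels, written as lists. -/
noncomputable def orderings (A : Finset ℕ) : Finset (List ℕ) := A.toList.permutations.toFinset

lemma mem_orderings {A : Finset ℕ} {l : List ℕ} :
    l ∈ orderings A ↔ l.Nodup ∧ l.toFinset = A := by
  rw [orderings, List.mem_toFinset, List.mem_permutations]
  constructor
  · intro h
    exact ⟨h.nodup_iff.2 A.nodup_toList, by rw [List.toFinset_eq_of_perm _ _ h, A.toList_toFinset]⟩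
  · rintro ⟨h, rfl⟩
    exact (List.toFinset_toList h).symm

lemma card_orderings (A : Finset ℕ) : (orderings A).card = A.card.factorial := by
  rw [orderings, List.toFinset_card_of_nodup (List.nodup_permutations _ A.nodup_toList),
    List.length_permutations, Finset.length_toList]

lemma sum_orderings_Icc (n : ℕ) (φ : List ℕ → ℕ) :
    ∑ l ∈ orderings (Finset.Icc 1 n), φ l = ((perms n).map φ).sum := by
  have hnodup : (List.range' 1 n).Nodup := List.nodup_range'
  rw [perms, ← List.sum_toFinset _ (List.nodup_permutations _ hnodup)]
  refine Finset.sum_congr ?_ fun _ _ => rfl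
  ext l
  rw [orderings, List.mem_toFinset, List.mem_toFinset, List.mem_permutations,
    List.mem_permutations]
  have : (Finset.Icc 1 n).toList.Perm (List.range' 1 n) := by
    rw [List.perm_ext_iff_of_nodup (Finset.nodup_toList _) hnodup]
    intro x
    simp [List.mem_range'_1]
    omega
  exact ⟨fun h => h.trans this, fun h => h.trans this.symm⟩

lemma sum_orderings_countBalAll (A : Finset ℕ) :
    ∑ l ∈ orderings A, countBalAll (treeOf l) = totalBal A.card := by
  rw [totalBal, ← sum_orderings_Icc]
  set g : ℕ → ℕ := fun x => (A.filter (· ≤ x)).card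
  have hmono : StrictMonoOn g A := fun x _ y hy hxy => by
    apply Finset.card_lt_card
    refine Finset.ssubset_iff_of_subset ?_ |>.2 ⟨y, ?_, ?_⟩
    · exact fun z hz => by
        rw [Finset.mem_filter] at hz ⊢
        exact ⟨hz.1, hz.2.trans hxy.le⟩
    · exact Finset.mem_filter.2 ⟨hy, le_rfl⟩
    · simp [hxy]
  have himg : A.image g = Finset.Icc 1 A.card := by
    apply Finset.eq_of_subset_of_card_le
    · intro y hy
      obtain ⟨x, hx, rfl⟩ := Finset.mem_image.1 hy
      exact Finset.mem_Icc.2 ⟨Finset.card_pos.2 ⟨x, Finset.mem_filter.2 ⟨hx, le_rfl⟩⟩,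
        Finset.card_filter_le _ _⟩
    · rw [Finset.card_image_of_injOn hmono.injOn]
      simp
  have hmem : ∀ l ∈ orderings A, ∀ x, x ∈ l ↔ x ∈ A := fun l hl x => by
    rw [← (mem_orderings.1 hl).2, List.mem_toFinset]
  have hmaps : ∀ l ∈ orderings A, l.map g ∈ orderings (Finset.Icc 1 A.card) := fun l hl => by
    have hl' := mem_orderings.1 hl
    refine mem_orderings.2 ⟨hl'.1.map_on fun x hx y hy h => hmono.injOn
      ((hmem l hl x).1 hx) ((hmem l hl y).1 hy) h, ?_⟩
    ext y
    simp [← himg, hmem l hl]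
  have hinj : Set.InjOn (List.map g) (orderings A : Set (List ℕ)) := by
    intro l hl l' hl' h
    have hinv : ∀ l ∈ orderings A, (l.map g).map (Function.invFunOn g A) = l := fun l hl => by
      rw [List.map_map]
      exact (List.map_congr_left fun x hx =>
        hmono.injOn.leftInvOn_invFunOn ((hmem l hl x).1 hx)).trans (List.map_id l)
    rw [← hinv l hl, h, hinv l' hl']
  refine Finset.sum_nbij (List.map g) hmaps hinj
    (Finset.surjOn_of_injOn_of_card_le _ hmaps hinj (by simp [card_orderings])) fun l hl => ?_
  rw [treeOf_map, countBalAll_relabel]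
  exact hmono.mono fun x hx => (hmem l hl x).1 hx

lemma sum_orderings_insert {A : Finset ℕ} {m : ℕ} (hm : m ∉ A) (φ : List ℕ → ℕ) :
    ∑ l ∈ orderings (insert m A), φ l =
      ∑ B ∈ A.powerset, ∑ l₁ ∈ orderings B, ∑ l₂ ∈ orderings (A \ B), φ (l₁ ++ m :: l₂) := by
  have hprod : ∀ B ∈ A.powerset,
      ∑ l₁ ∈ orderings B, ∑ l₂ ∈ orderings (A \ B), φ (l₁ ++ m :: l₂) =
      ∑ q ∈ orderings B ×ˢ orderings (A \ B), φ (q.1 ++ m :: q.2) := fun B _ => by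
    rw [Finset.sum_product]
  rw [Finset.sum_congr rfl hprod, Finset.sum_sigma']
  symm
  refine Finset.sum_nbij (fun q => q.2.1 ++ m :: q.2.2) ?_ ?_ ?_ fun _ _ => rfl
  · rintro ⟨B, l₁, l₂⟩ h
    simp only [Finset.mem_sigma, Finset.mem_powerset, Finset.mem_product, mem_orderings] at h ⊢
    obtain ⟨hB, ⟨hn₁, rfl⟩, hn₂, h₂⟩ := h
    have e₂ : ∀ x, x ∈ l₂ ↔ x ∈ A ∧ x ∉ l₁ := fun x => by
      rw [← List.mem_toFinset, h₂]; simp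
    have e₁ : ∀ x ∈ l₁, x ∈ A := fun x hx => hB (List.mem_toFinset.2 hx)
    constructor
    · rw [List.nodup_append, List.nodup_cons]
      refine ⟨hn₁, ⟨fun h => hm ((e₂ m).1 h).1, hn₂⟩, ?_⟩
      rintro x hx y hy rfl
      rcases List.mem_cons.1 hy with rfl | hy
      · exact hm (e₁ _ hx)
      · exact ((e₂ _).1 hy).2 hx
    · ext x
      simp only [List.mem_toFinset, List.mem_append, List.mem_cons, Finset.mem_insert, e₂]
      have := e₁ x
      tauto
  · rintro ⟨B, l₁, l₂⟩ h ⟨B', l₁', l₂'⟩ h' heq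
    simp only [Finset.coe_sigma, Set.mem_sigma_iff, Finset.mem_coe, Finset.mem_powerset,
      Finset.mem_product, mem_orderings] at h h' heq
    obtain ⟨hB, ⟨hn₁, rfl⟩, hn₂, h₂⟩ := h
    obtain ⟨hB', ⟨hn₁', rfl⟩, hn₂', h₂'⟩ := h'
    have n₁ : m ∉ l₁ := fun h => hm (hB (List.mem_toFinset.2 h))
    have n₁' : m ∉ l₁' := fun h => hm (hB' (List.mem_toFinset.2 h))
    have e₁ := congrArg (List.takeWhile (· != m)) heq
    have e₂ := congrArg (List.dropWhile (· != m)) heq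
    rw [takeWhile_bne_append_cons n₁, takeWhile_bne_append_cons n₁'] at e₁
    rw [dropWhile_bne_append_cons n₁, dropWhile_bne_append_cons n₁', List.cons.injEq] at e₂
    rw [e₁, e₂.2]
  · intro l hl
    rw [Finset.mem_coe, mem_orderings] at hl
    obtain ⟨hn, hA⟩ := hl
    have hml : m ∈ l := by rw [← List.mem_toFinset, hA]; simp
    obtain ⟨l₁, l₂, rfl⟩ := List.append_of_mem hml
    rw [List.nodup_append, List.nodup_cons] at hn
    obtain ⟨hn₁, ⟨hm₂, hn₂⟩, hd⟩ := hn
    have hm₁ : m ∉ l₁ := fun h => hd m h m (by simp) rfl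
    have hd' : ∀ x ∈ l₁, x ∉ l₂ := fun x h₁ h₂ => hd x h₁ x (by simp [h₂]) rfl
    have e : ∀ x, x ∈ A ↔ x ∈ l₁ ∨ x ∈ l₂ := fun x => by
      have := congrArg (x ∈ ·) hA
      simp only [List.mem_toFinset, List.mem_append, List.mem_cons, Finset.mem_insert,
        eq_iff_iff] at this
      rcases eq_or_ne x m with rfl | hx
      · tauto
      · tauto
    refine ⟨⟨l₁.toFinset, l₁, l₂⟩, ?_, rfl⟩
    simp only [Finset.coe_sigma, Set.mem_sigma_iff, Finset.mem_coe, Finset.mem_powerset,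
      Finset.mem_product, mem_orderings]
    refine ⟨fun x hx => (e x).2 (Or.inl (List.mem_toFinset.1 hx)), ⟨hn₁, trivial⟩, hn₂, ?_⟩
    ext x
    have := hd' x
    simp only [List.mem_toFinset, Finset.mem_sdiff, e]
    tauto

lemma totalBal_succ (n : ℕ) :
    totalBal (n + 1) = rootBal (n + 1) +
      ∑ k ∈ Finset.range (n + 1), n.choose k *
        (totalBal k * (n - k).factorial + k.factorial * totalBal (n - k)) := by
  have hroot : rootBal (n + 1) = ∑ l ∈ orderings (Finset.Icc 1 (n + 1)),
      if (balRank (treeOf l)).isSome then 1 else 0 := by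
    rw [sum_orderings_Icc, rootBal]
    induction perms (n + 1) with
    | nil => rfl
    | cons l L ih =>
      rw [List.map_cons, List.sum_cons, ← ih, List.filter_cons]
      split_ifs <;> simp [add_comm]
  have hins : Finset.Icc 1 (n + 1) = insert (n + 1) (Finset.Icc 1 n) := by
    ext x; simp; omega
  have hnot : n + 1 ∉ Finset.Icc 1 n := by simp
  rw [hroot, totalBal, ← sum_orderings_Icc, hins, sum_orderings_insert hnot,
    sum_orderings_insert hnot]
  have hcard : (Finset.Icc 1 n).card = n := by simp
  have hsum := Finset.sum_powerset_apply_card (fun k =>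
    totalBal k * (n - k).factorial + k.factorial * totalBal (n - k)) (x := Finset.Icc 1 n)
  simp only [hcard, smul_eq_mul] at hsum
  rw [← hsum, ← Finset.sum_add_distrib]
  refine Finset.sum_congr rfl fun B hB => ?_
  have hB := Finset.mem_powerset.1 hB
  have hc : (Finset.Icc 1 n \ B).card = n - B.card := by
    rw [Finset.card_sdiff_of_subset hB, hcard]
  have hlt : ∀ {C : Finset ℕ}, C ⊆ Finset.Icc 1 n → ∀ {l}, l ∈ orderings C → ∀ x ∈ l,
      x < n + 1 := by
    intro C hC l hl x hx
    rw [← List.mem_toFinset, (mem_orderings.1 hl).2] at hx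
    exact Nat.lt_succ_of_le (Finset.mem_Icc.1 (hC hx)).2
  have hsplit : ∑ l₁ ∈ orderings B, ∑ l₂ ∈ orderings (Finset.Icc 1 n \ B),
      (countBalAll (treeOf l₁) + countBalAll (treeOf l₂)) =
      totalBal B.card * (n - B.card).factorial + B.card.factorial * totalBal (n - B.card) := by
    simp only [Finset.sum_add_distrib, Finset.sum_const, smul_eq_mul, card_orderings,
      sum_orderings_countBalAll, hc, ← Finset.mul_sum]
    ring
  rw [← hsplit, ← Finset.sum_add_distrib]
  refine Finset.sum_congr rfl fun l₁ h₁ => ?_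
  rw [← Finset.sum_add_distrib]
  refine Finset.sum_congr rfl fun l₂ h₂ => ?_
  rw [treeOf_append_cons (hlt hB h₁) (hlt Finset.sdiff_subset h₂), countBalAll, add_comm]

lemma totalBal_eq (n : ℕ) : (totalBal n : ℚ) = n.factorial * (n * Pbal n) := by
  rcases eq_or_ne n 0 with rfl | hn
  · simp [totalBal, perms, treeOf, treeOfAux, countBalAll]
  · have : (n.factorial : ℚ) ≠ 0 := by exact_mod_cast n.factorial_ne_zero
    have : (n : ℚ) ≠ 0 := by exact_mod_cast hn
    rw [Pbal]
    field_simp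

end BalancedTrees

open BalancedTrees

/-- For every `n ≥ 1`,
`P(n) = (p(n) + (2/n) * ∑_{i=1}^{n-1} i * P(i)) / n`, where `P(n)` is the
probability that a uniformly random vertex of all decreasing binary trees on
`{1,…,n}` is balanced and `p(n)` is the probability that the root of a
uniformly random such tree is balanced. -/
theorem statement6 (n : ℕ) (hn : 1 ≤ n) :
    Pbal n =
      (proot n + (2 / (n : ℚ)) * ∑ i ∈ Finset.Icc 1 (n - 1), (i : ℚ) * Pbal i)
        / (n : ℚ) := by
  obtain ⟨n, rfl⟩ : ∃ j, n = j + 1 := ⟨n - 1, by omega⟩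
  have hterm : ∀ k ∈ Finset.range (n + 1), ((n.choose k *
      (totalBal k * (n - k).factorial + k.factorial * totalBal (n - k)) : ℕ) : ℚ) =
      n.factorial * (k * Pbal k + (n - k : ℕ) * Pbal (n - k)) := fun k hk => by
    have hk : k ≤ n := Nat.lt_succ_iff.1 (Finset.mem_range.1 hk)
    push_cast
    rw [totalBal_eq, totalBal_eq, ← Nat.choose_mul_factorial_mul_factorial hk]
    push_cast
    ring
  have hrefl := Finset.sum_range_reflect (fun k : ℕ => (k : ℚ) * Pbal k) (n + 1)
  simp only [Nat.add_sub_cancel] at hrefl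
  have hIcc : ∑ i ∈ Finset.Icc 1 n, (i : ℚ) * Pbal i =
      ∑ i ∈ Finset.range (n + 1), (i : ℚ) * Pbal i := by
    refine Finset.sum_subset (fun x hx => by simp at hx ⊢; omega) fun x hx hx' => ?_
    obtain rfl : x = 0 := by simp at hx hx'; omega
    simp
  have h := congrArg (Nat.cast : ℕ → ℚ) (totalBal_succ n)
  rw [Nat.cast_add, Nat.cast_sum, Finset.sum_congr rfl hterm, ← Finset.mul_sum,
    Finset.sum_add_distrib, hrefl, ← hIcc] at h
  have hf : (n.factorial : ℚ) ≠ 0 := by exact_mod_cast n.factorial_ne_zero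
  have hn' : (n : ℚ) + 1 ≠ 0 := by positivity
  rw [Pbal, h, proot, Nat.add_sub_cancel, Nat.factorial_succ]
  push_cast
  field_simp
  ring
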